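/- arXiv:2306.07107 — 4 statements merged into one kernel-verified Lean document; each statement's English description precedes it below -/
import Mathlib

section
/- Let T > 0, let ψ₁,…,ψ_N : [0,T] → ℝ be continuous and linearly independent (as elements of the vector space of functions on [0,T]), write Λ(t) := (ψ₁(t),…,ψ_N(t)) ∈ ℝ^N, and let U ⊆ ℝ^m be compact. Then the set {α ∈ ℝ^{m×N} : αΛ(t) ∈ U for all t ∈ [0,T]} is a compact subset of ℝ^{m×N}. -/
open Matrix Set

/-- The linear map sending a coefficient matrix `α` to the trajectory `s ↦ α Λ(s)`. -/
def trajectoryMap {S : Type*} {m N : ℕ} (ψ : Fin N → S → ℝ) :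
    Matrix (Fin m) (Fin N) ℝ →ₗ[ℝ] (S → Fin m → ℝ) where
  toFun α s := α *ᵥ fun j => ψ j s
  map_add' α β := by ext; simp [add_mulVec]
  map_smul' c α := by ext; simp [smul_mulVec]

lemma trajectoryMap_injective {S : Type*} {m N : ℕ} {ψ : Fin N → S → ℝ}
    (hψ : LinearIndependent ℝ ψ) : Function.Injective (trajectoryMap (m := m) ψ) := by
  refine (injective_iff_map_eq_zero _).2 fun α hα => ?_
  ext i j
  refine Fintype.linearIndependent_iff.1 hψ (α i) ?_ j
  ext s
  simpa [trajectoryMap, mulVec, dotProduct] using congrFun (congrFun hα s) i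

/-- if the basis functions `ψ₁,…,ψ_N` are continuous and linearly independent
on `[0,T]` and `U` is compact, then the set of coefficient matrices whose associated control
trajectory `t ↦ α Λ(t)` takes values in `U` for all `t ∈ [0,T]` is compact. -/
theorem coeff_set_isCompact {m N : ℕ} (T : ℝ) (hT : 0 < T)
    (ψ : Fin N → ℝ → ℝ) (hψ : ∀ i, ContinuousOn (ψ i) (Icc 0 T))
    (hind : LinearIndependent ℝ fun i => (Icc (0:ℝ) T).restrict (ψ i))
    (U : Set (Fin m → ℝ)) (hU : IsCompact U) :
    IsCompact {α : Matrix (Fin m) (Fin N) ℝ |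
      ∀ t ∈ Icc (0:ℝ) T, (α.mulVec fun j => ψ j t) ∈ U} := by
  have hemb := LinearMap.isClosedEmbedding_of_injective
    (LinearMap.ker_eq_bot.2 (trajectoryMap_injective (m := m) hind))
  -- Tychonoff: the trajectories with values in `U` form a compact set for pointwise convergence.
  convert hemb.isCompact_preimage (isCompact_univ_pi fun _ : Icc (0:ℝ) T => hU) using 1
  ext α
  exact ⟨fun h t _ => h t t.2, fun h t ht => h ⟨t, ht⟩ trivial⟩
end

section
/- (Finite reduction of a convex semi-infinite program.) Let T > 0, let K ⊆ ℝ^n be compact and convex, let f : ℝ^n → ℝ be convex and continuous, and let φ : [0,T] × ℝ^n → ℝ be continuous and such that α ↦ φ(t,α) is convex for each t ∈ [0,T]. Assume the Slater condition: there exists α̂ ∈ K with φ(t, α̂) < 0 for all t ∈ [0,T]. For τ = (t₁,…,t_n) ∈ [0,T]^n define g(τ) := inf{f(α) : α ∈ K, φ(t_i, α) ≤ 0 for i = 1,…,n}. Then the supremum of g over [0,T]^n is attained at some τ* ∈ [0,T]^n, and g(τ*) = inf{f(α) : α ∈ K, φ(t,α) ≤ 0 for all t ∈ [0,T]}. -/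
open Set

/-- A finset with at most `n` elements is covered by some family indexed by `Fin n`. -/
theorem Finset.exists_fin_cover {ι : Type*} [Nonempty ι] {n : ℕ} (S : Finset ι) (hS : S.card ≤ n) :
    ∃ τ : Fin n → ι, ∀ x ∈ S, ∃ i, τ i = x := by
  have hinj : Function.Injective (Fin.castLE hS ∘ S.equivFin) :=
    (Fin.castLE_injective hS).comp S.equivFin.injective
  refine ⟨Function.extend (Fin.castLE hS ∘ S.equivFin) Subtype.val
    fun _ => Classical.arbitrary ι, fun x hx => ⟨_, hinj.extend_apply _ _ ⟨x, hx⟩⟩⟩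

section ConvexSystem

variable {ι E : Type*} [Nonempty ι] [NormedAddCommGroup E] [NormedSpace ℝ E]
  {K : Set E} {f : E → ℝ} {φ : ι → E → ℝ} {n : ℕ}

/-- Helly-type statement: if the system `φ t ≤ 0` is feasible on a compact convex set `K`, and the
sublevel `f ≤ m` can be reached on `K` under any `dim E` of the constraints, then it can be
reached under all of them. -/
theorem exists_le_forall_nonpos_of_finite [FiniteDimensional ℝ E] (hn : Module.finrank ℝ E = n)
    (hK : IsCompact K) (hKconv : Convex ℝ K)
    (hf : Continuous f) (hfconv : ConvexOn ℝ univ f)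
    (hφ : ∀ t, Continuous (φ t)) (hφconv : ∀ t, ConvexOn ℝ univ (φ t))
    (hfeas : ∃ α ∈ K, ∀ t, φ t α ≤ 0) {m : ℝ}
    (hm : ∀ τ : Fin n → ι, ∃ α ∈ K, f α ≤ m ∧ ∀ i, φ (τ i) α ≤ 0) :
    ∃ α ∈ K, f α ≤ m ∧ ∀ t, φ t α ≤ 0 := by
  let ψ : Option ι → E → ℝ := fun o => o.elim (fun α => f α - m) φ
  have hψ : ∀ o, Continuous (ψ o) := by
    rintro (_ | t)
    · exact hf.sub continuous_const
    · exact hφ t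
  have hψconv : ∀ o, ConvexOn ℝ univ (ψ o) := by
    rintro (_ | t)
    · exact hfconv.sub (concaveOn_const m convex_univ)
    · exact hφconv t
  obtain ⟨α, hα⟩ : (⋂ o, K ∩ {α | ψ o α ≤ 0}).Nonempty := by
    refine Convex.helly_theorem_compact' (𝕜 := ℝ) (fun o => hKconv.inter ?_)
      (fun o => hK.inter_right (isClosed_le (hψ o) continuous_const)) fun I hI => ?_
    · simpa using (hψconv o).convex_le 0
    by_cases hnone : none ∈ I
    · have hcard : I.eraseNone.card ≤ n := by
        rw [Finset.card_eraseNone_of_mem hnone]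
        omega
      obtain ⟨τ, hτ⟩ := I.eraseNone.exists_fin_cover hcard
      obtain ⟨α, hαK, hαm, hατ⟩ := hm τ
      refine ⟨α, mem_iInter₂.2 ?_⟩
      rintro (_ | t) ht
      · exact ⟨hαK, sub_nonpos.2 hαm⟩
      · obtain ⟨i, rfl⟩ := hτ t (Finset.mem_eraseNone.2 ht)
        exact ⟨hαK, hατ i⟩
    · obtain ⟨α, hαK, hα⟩ := hfeas
      refine ⟨α, mem_iInter₂.2 ?_⟩
      rintro (_ | t) ht
      · exact absurd ht hnone
      · exact ⟨hαK, hα t⟩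
  rw [mem_iInter] at hα
  exact ⟨α, (hα none).1, sub_nonpos.1 (hα none).2, fun t => (hα (some t)).2⟩

/-- Moving towards a Slater point makes finitely many weak inequalities strict while keeping
the objective below a strict upper bound. -/
theorem exists_lt_forall_neg_of_slater {κ : Type*} (hKconv : Convex ℝ K)
    (hf : Continuous f) {ψ : κ → E → ℝ} (hψconv : ∀ i, ConvexOn ℝ univ (ψ i))
    {α₀ : E} (hα₀ : α₀ ∈ K) (hneg : ∀ i, ψ i α₀ < 0) {V : ℝ}
    {α : E} (hα : α ∈ K) (hαV : f α < V) (hαψ : ∀ i, ψ i α ≤ 0) :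
    ∃ β ∈ K, f β < V ∧ ∀ i, ψ i β < 0 := by
  have hcont : Continuous fun s : ℝ => f ((1 - s) • α + s • α₀) := by fun_prop
  have hev : ∀ᶠ s in nhdsWithin (0 : ℝ) (Ioi 0), f ((1 - s) • α + s • α₀) < V :=
    (hcont.continuousAt.eventually_lt continuousAt_const (by simpa using hαV)).filter_mono
      nhdsWithin_le_nhds
  obtain ⟨s, hsV, hs0, hs1⟩ := (hev.and (Ioo_mem_nhdsGT (zero_lt_one' ℝ))).exists
  have h1s : 0 ≤ 1 - s := sub_nonneg.2 hs1.le
  refine ⟨(1 - s) • α + s • α₀, hKconv hα hα₀ h1s hs0.le (by ring), hsV, fun i => ?_⟩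
  have hle := (hψconv i).2 (mem_univ α) (mem_univ α₀) h1s hs0.le (by ring)
  simp only [smul_eq_mul] at hle
  linarith [mul_nonpos_of_nonneg_of_nonpos h1s (hαψ i), mul_neg_of_pos_of_neg hs0 (hneg i)]

/-- Under the Slater condition, some `dim E` constraints already force every lower bound of a
convex objective that holds under all constraints. -/
theorem exists_finite_constraints_forall_le [TopologicalSpace ι] [CompactSpace ι]
    [FiniteDimensional ℝ E] (hn : Module.finrank ℝ E = n)
    (hK : IsCompact K) (hKconv : Convex ℝ K)
    (hf : Continuous f) (hfconv : ConvexOn ℝ univ f)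
    (hφ : ∀ t, Continuous (φ t)) (hφt : ∀ α, Continuous fun t => φ t α)
    (hφconv : ∀ t, ConvexOn ℝ univ (φ t))
    (hslater : ∃ α₀ ∈ K, ∀ t, φ t α₀ < 0) {V : ℝ}
    (hV : ∀ α ∈ K, (∀ t, φ t α ≤ 0) → V ≤ f α) :
    ∃ τ : Fin n → ι, ∀ α ∈ K, (∀ i, φ (τ i) α ≤ 0) → V ≤ f α := by
  by_contra! hcon
  obtain ⟨α₀, hα₀, hneg⟩ := hslater
  obtain ⟨m, hmV, hm⟩ : ∃ m < V, ∀ τ ∈ (univ : Set (Fin n → ι)),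
      ∃ α ∈ K, f α ≤ m ∧ ∀ i, φ (τ i) α ≤ 0 := by
    refine isCompact_univ.induction_on ⟨V - 1, by linarith, by simp⟩ ?_ ?_ ?_
    · rintro s t hst ⟨m, hmV, hm⟩
      exact ⟨m, hmV, fun τ hτ => hm τ (hst hτ)⟩
    · rintro s t ⟨m, hmV, hm⟩ ⟨m', hmV', hm'⟩
      refine ⟨max m m', max_lt hmV hmV', ?_⟩
      rintro τ (hτ | hτ)
      · obtain ⟨α, hαK, hαm, hα⟩ := hm τ hτ
        exact ⟨α, hαK, le_max_of_le_left hαm, hα⟩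
      · obtain ⟨α, hαK, hαm, hα⟩ := hm' τ hτ
        exact ⟨α, hαK, le_max_of_le_right hαm, hα⟩
    · intro τ _
      obtain ⟨α, hαK, hατ, hαV⟩ := hcon τ
      obtain ⟨β, hβK, hβV, hβ⟩ := exists_lt_forall_neg_of_slater hKconv hf
        (fun i => hφconv (τ i)) hα₀ (fun i => hneg (τ i)) hαK hαV hατ
      have hopen : IsOpen {σ : Fin n → ι | ∀ i, φ (σ i) β < 0} := by
        simp only [Set.ofPred_forall]
        exact isOpen_iInter_of_finite fun i =>
          isOpen_lt ((hφt β).comp (continuous_apply i)) continuous_const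
      exact ⟨_, mem_nhdsWithin_of_mem_nhds (hopen.mem_nhds hβ), f β, hβV,
        fun σ hσ => ⟨β, hβK, le_rfl, fun i => (hσ i).le⟩⟩
  obtain ⟨α, hαK, hαm, hα⟩ := exists_le_forall_nonpos_of_finite hn hK hKconv hf hfconv hφ hφconv
    ⟨α₀, hα₀, fun t => (hneg t).le⟩ fun τ => hm τ (mem_univ τ)
  exact ((hV α hαK hα).trans hαm).not_gt hmV

end ConvexSystem

/-- finite reduction of a convex semi-infinite program: for a compact convex
set `K ⊆ ℝⁿ`, a convex continuous objective `f`, a continuous constraint function `φ` that is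
convex in the decision variable for each time instant, and under the Slater condition, the
supremum over `τ ∈ [0,T]ⁿ` of the relaxed value
`g(τ) = inf {f(α) : α ∈ K, φ(τᵢ, α) ≤ 0, i = 1,…,n}` is attained at some `τ*`, and its value
`g(τ*)` equals the optimal value of the semi-infinite program
`inf {f(α) : α ∈ K, φ(t, α) ≤ 0 for all t ∈ [0,T]}`. -/
theorem sip_finite_reduction {n : ℕ} (T : ℝ) (hT : 0 < T)
    (K : Set (Fin n → ℝ)) (hK : IsCompact K) (hKconv : Convex ℝ K)
    (f : (Fin n → ℝ) → ℝ) (hf : Continuous f) (hfconv : ConvexOn ℝ Set.univ f)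
    (φ : ℝ → (Fin n → ℝ) → ℝ)
    (hφcont : ContinuousOn (fun p : ℝ × (Fin n → ℝ) => φ p.1 p.2)
      (Icc 0 T ×ˢ Set.univ))
    (hφconv : ∀ t ∈ Icc (0:ℝ) T, ConvexOn ℝ Set.univ (φ t))
    (hslater : ∃ α₀ ∈ K, ∀ t ∈ Icc (0:ℝ) T, φ t α₀ < 0) :
    ∃ τs : Fin n → ℝ, (∀ i, τs i ∈ Icc (0:ℝ) T) ∧
      (∀ τ : Fin n → ℝ, (∀ i, τ i ∈ Icc (0:ℝ) T) →
        sInf (f '' {α | α ∈ K ∧ ∀ i, φ (τ i) α ≤ 0}) ≤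
          sInf (f '' {α | α ∈ K ∧ ∀ i, φ (τs i) α ≤ 0})) ∧
      sInf (f '' {α | α ∈ K ∧ ∀ i, φ (τs i) α ≤ 0}) =
        sInf (f '' {α | α ∈ K ∧ ∀ t ∈ Icc (0:ℝ) T, φ t α ≤ 0}) := by
  obtain ⟨α₀, hα₀, hneg⟩ := hslater
  have hbdd : ∀ P : (Fin n → ℝ) → Prop, BddBelow (f '' {α | α ∈ K ∧ P α}) := fun P =>
    (hK.image hf).bddBelow.mono (image_mono fun _ h => h.1)
  have hle : ∀ τ : Fin n → ℝ, (∀ i, τ i ∈ Icc (0:ℝ) T) →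
      sInf (f '' {α | α ∈ K ∧ ∀ i, φ (τ i) α ≤ 0}) ≤
        sInf (f '' {α | α ∈ K ∧ ∀ t ∈ Icc (0:ℝ) T, φ t α ≤ 0}) := fun τ hτ =>
    csInf_le_csInf (hbdd _) ⟨f α₀, α₀, ⟨hα₀, fun t ht => (hneg t ht).le⟩, rfl⟩
      (image_mono fun α hα => ⟨hα.1, fun i => hα.2 _ (hτ i)⟩)
  have : Nonempty (Icc (0:ℝ) T) := ⟨⟨0, left_mem_Icc.2 hT.le⟩⟩
  obtain ⟨τ, hτ⟩ := exists_finite_constraints_forall_le (ι := Icc (0:ℝ) T)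
    (φ := fun t α => φ t α) (Module.finrank_fin_fun ℝ) hK hKconv hf hfconv
    (fun t => hφcont.comp_continuous (Continuous.prodMk_right (t : ℝ))
      fun α => ⟨t.2, mem_univ α⟩)
    (fun α => hφcont.comp_continuous (continuous_subtype_val.prodMk continuous_const)
      fun t => ⟨t.2, mem_univ α⟩)
    (fun t => hφconv t t.2) ⟨α₀, hα₀, fun t => hneg t t.2⟩
    fun α hαK hα => csInf_le (hbdd fun α => ∀ t ∈ Icc (0:ℝ) T, φ t α ≤ 0)
      ⟨α, ⟨hαK, fun t ht => hα ⟨t, ht⟩⟩, rfl⟩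
  have hge : sInf (f '' {α | α ∈ K ∧ ∀ t ∈ Icc (0:ℝ) T, φ t α ≤ 0}) ≤
      sInf (f '' {α | α ∈ K ∧ ∀ i, φ (τ i) α ≤ 0}) := by
    refine le_csInf ⟨f α₀, α₀, ⟨hα₀, fun i => (hneg _ (τ i).2).le⟩, rfl⟩ ?_
    rintro _ ⟨α, hα, rfl⟩
    exact hτ α hα.1 hα.2
  exact ⟨fun i => τ i, fun i => (τ i).2, fun σ hσ => (hle σ hσ).trans hge,
    (hle _ fun i => (τ i).2).antisymm hge⟩
end

section
/- (Bryson–Denham lower bound.) Let x : [0,1] → ℝ be twice continuously differentiable with x(0) = 0, x'(0) = 1, x(1) = 0, x'(1) = −1, and x(t) ≤ 1/9 for all t ∈ [0,1]. Then ∫₀¹ x''(t)² dt ≥ 8. -/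
open Set intervalIntegral

/-- Completing the square against the affine function `t ↦ p * t + q` bounds the energy of the
second derivative from below by boundary terms. -/
theorem affine_dual_le_integral_sq {x v a : ℝ → ℝ} {c d : ℝ} (hcd : c ≤ d)
    (hx : ∀ t ∈ Icc c d, HasDerivWithinAt x (v t) (Icc c d) t)
    (hv : ∀ t ∈ Icc c d, HasDerivWithinAt v (a t) (Icc c d) t)
    (ha : ContinuousOn a (Icc c d)) (p q : ℝ) :
    (2 * (v d * (p * d + q) - p * x d) - (p ^ 2 * d ^ 3 / 3 + p * q * d ^ 2 + q ^ 2 * d)) -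
      (2 * (v c * (p * c + q) - p * x c) - (p ^ 2 * c ^ 3 / 3 + p * q * c ^ 2 + q ^ 2 * c)) ≤
      ∫ t in c..d, (a t) ^ 2 := by
  have key : ∀ t ∈ Icc c d, HasDerivWithinAt
      (fun t => 2 * (v t * (p * t + q) - p * x t) -
        (p ^ 2 * t ^ 3 / 3 + p * q * t ^ 2 + q ^ 2 * t))
      (2 * a t * (p * t + q) - (p * t + q) ^ 2) (Icc c d) t := by
    intro t ht
    have hw : HasDerivWithinAt (fun t : ℝ => p * t + q) p (Icc c d) t := by
      simpa using ((hasDerivAt_id t).const_mul p).add_const q |>.hasDerivWithinAt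
    have hW : HasDerivWithinAt (fun t : ℝ => p ^ 2 * t ^ 3 / 3 + p * q * t ^ 2 + q ^ 2 * t)
        (p ^ 2 * (3 * t ^ 2) / 3 + p * q * (2 * t) + q ^ 2) (Icc c d) t := by
      exact (((((hasDerivAt_pow 3 t).const_mul (p ^ 2)).div_const 3).add
        ((hasDerivAt_pow 2 t).const_mul (p * q))).add ((hasDerivAt_id t).const_mul (q ^ 2))
        |>.congr_deriv (by norm_num)).hasDerivWithinAt
    exact (((((hv t ht).mul hw).sub ((hx t ht).const_mul p)).const_mul 2).sub hW).congr_deriv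
      (by ring)
  refine sub_le_integral_of_hasDeriv_right_of_le hcd
    (fun t ht => (key t ht).continuousWithinAt)
    (fun t ht => ((key t (Ioo_subset_Icc_self ht)).hasDerivAt
      (Icc_mem_nhds ht.1 ht.2)).hasDerivWithinAt)
    (ha.pow 2).integrableOn_Icc (fun t _ => ?_)
  nlinarith [sq_nonneg (a t - (p * t + q))]

/-- Bryson–Denham lower bound: any twice continuously differentiable
`x : [0,1] → ℝ` (with first derivative `v` and continuous second derivative `a`) satisfying
`x(0) = 0`, `x'(0) = 1`, `x(1) = 0`, `x'(1) = −1` and the path constraint `x(t) ≤ 1/9` on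
`[0,1]` has control energy `∫₀¹ x''(t)² dt ≥ 8`. -/
theorem bryson_denham_lower_bound (x v a : ℝ → ℝ)
    (hx : ∀ t ∈ Icc (0:ℝ) 1, HasDerivWithinAt x (v t) (Icc 0 1) t)
    (hv : ∀ t ∈ Icc (0:ℝ) 1, HasDerivWithinAt v (a t) (Icc 0 1) t)
    (ha : ContinuousOn a (Icc 0 1))
    (hx0 : x 0 = 0) (hv0 : v 0 = 1) (hx1 : x 1 = 0) (hv1 : v 1 = -1)
    (hpath : ∀ t ∈ Icc (0:ℝ) 1, x t ≤ 1 / 9) :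
    8 ≤ ∫ t in (0:ℝ)..1, (a t) ^ 2 := by
  have sub : ∀ {c d : ℝ}, 0 ≤ c → d ≤ 1 → Icc c d ⊆ Icc (0:ℝ) 1 := fun hc hd =>
    Icc_subset_Icc hc hd
  have bound : ∀ {c d : ℝ}, 0 ≤ c → c ≤ d → d ≤ 1 → ∀ p q : ℝ, _ := fun {c d} hc hcd hd p q =>
    affine_dual_le_integral_sq hcd
      (fun t ht => (hx t (sub hc hd ht)).mono (sub hc hd))
      (fun t ht => (hv t (sub hc hd ht)).mono (sub hc hd)) (ha.mono (sub hc hd)) p q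
  have int : ∀ {c d : ℝ}, 0 ≤ c → c ≤ d → d ≤ 1 →
      IntervalIntegrable (fun t => (a t) ^ 2) MeasureTheory.volume c d := fun hc hcd hd =>
    ((ha.mono (sub hc hd)).pow 2).intervalIntegrable_of_Icc hcd
  have left := bound (c := 0) (d := 1 / 3) (by norm_num) (by norm_num) (by norm_num) 18 (-6)
  have mid := bound (c := 1 / 3) (d := 2 / 3) (by norm_num) (by norm_num) (by norm_num) 0 0
  have right := bound (c := 2 / 3) (d := 1) (by norm_num) (by norm_num) (by norm_num) (-18) 12
  have hl := hpath (1 / 3) (by norm_num)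
  have hr := hpath (2 / 3) (by norm_num)
  rw [← integral_add_adjacent_intervals (b := 2 / 3)
      (int (by norm_num) (by norm_num) (by norm_num))
      (int (by norm_num) (by norm_num) (by norm_num)),
    ← integral_add_adjacent_intervals (b := 1 / 3)
      (int (by norm_num) (by norm_num) (by norm_num))
      (int (by norm_num) (by norm_num) (by norm_num))]
  rw [hx0, hv0] at left
  rw [hx1, hv1] at right
  linarith
end

section
/- (Bryson–Denham achievability.) Define x : [0,1] → ℝ by x(t) = (1/9)(1 − (1 − 3t)³) for t ∈ [0,1/3], x(t) = 1/9 for t ∈ [1/3,2/3], and x(t) = (1/9)(1 − (3t − 2)³) for t ∈ [2/3,1]. Then x is twice continuously differentiable on [0,1], satisfies x(0) = 0, x'(0) = 1, x(1) = 0, x'(1) = −1, and x(t) ≤ 1/9 for all t ∈ [0,1], and its second derivative satisfies ∫₀¹ x''(t)² dt = 8. -/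
open Set intervalIntegral

/-- The analytical optimal Bryson–Denham state trajectory. -/
noncomputable def brysonDenhamX (t : ℝ) : ℝ :=
  if t ≤ 1 / 3 then (1 / 9) * (1 - (1 - 3 * t) ^ 3)
  else if t ≤ 2 / 3 then 1 / 9
  else (1 / 9) * (1 - (3 * t - 2) ^ 3)

/-- Powers of the positive part of exponent at least two are differentiable everywhere. -/
theorem hasDerivAt_max_zero_pow (n : ℕ) (s : ℝ) :
    HasDerivAt (fun s : ℝ => max s 0 ^ (n + 2)) ((n + 2) * max s 0 ^ (n + 1)) s := by
  have h : ∀ y ≠ (0 : ℝ),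
      HasDerivAt (fun s : ℝ => max s 0 ^ (n + 2)) ((n + 2) * max y 0 ^ (n + 1)) y := by
    intro y hy
    rcases lt_or_gt_of_ne hy with hy | hy
    · have heq : (fun s : ℝ => max s 0 ^ (n + 2)) =ᶠ[nhds y] fun _ => 0 := by
        filter_upwards [Iio_mem_nhds hy] with z hz
        simp [max_eq_right (le_of_lt (mem_Iio.mp hz))]
      simpa [max_eq_right hy.le] using (hasDerivAt_const y (0 : ℝ)).congr_of_eventuallyEq heq
    · have heq : (fun s : ℝ => max s 0 ^ (n + 2)) =ᶠ[nhds y] fun s => s ^ (n + 2) := by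
        filter_upwards [Ioi_mem_nhds hy] with z hz
        rw [max_eq_left (le_of_lt (mem_Ioi.mp hz))]
      simpa [max_eq_left hy.le] using (hasDerivAt_pow (n + 2) y).congr_of_eventuallyEq heq
  exact hasDerivAt_of_hasDerivAt_of_ne' (x := 0) h (by fun_prop) (by fun_prop) s

/-- Derivative of a power of the positive part of an affine function. -/
theorem hasDerivAt_max_affine_pow (n : ℕ) (b c t : ℝ) :
    HasDerivAt (fun t : ℝ => max (b * t + c) 0 ^ (n + 2))
      ((n + 2) * max (b * t + c) 0 ^ (n + 1) * b) t := by
  have h : HasDerivAt (fun t : ℝ => b * t + c) b t := by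
    simpa using ((hasDerivAt_id t).const_mul b).add_const c
  exact (hasDerivAt_max_zero_pow n (b * t + c)).comp t h

theorem brysonDenhamX_eq_max :
    brysonDenhamX = fun t : ℝ =>
      1 / 9 * (1 - max (-3 * t + 1) 0 ^ 3 - max (3 * t + -2) 0 ^ 3) := by
  funext t
  unfold brysonDenhamX
  split_ifs with h₁ h₂
  · rw [max_eq_left (by linarith : 0 ≤ -3 * t + 1), max_eq_right (by linarith : 3 * t + -2 ≤ 0)]
    ring
  · rw [max_eq_right (by linarith : -3 * t + 1 ≤ 0), max_eq_right (by linarith : 3 * t + -2 ≤ 0)]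
    ring
  · rw [max_eq_right (by linarith : -3 * t + 1 ≤ 0), max_eq_left (by linarith : 0 ≤ 3 * t + -2)]
    ring

/-- Bryson–Denham achievability: the trajectory `brysonDenhamX` is twice
continuously differentiable on `[0,1]` (witnessed by a first derivative `v` and a continuous
second derivative `a`), satisfies the boundary conditions `x(0) = 0`, `x'(0) = 1`, `x(1) = 0`,
`x'(1) = −1`, respects the path constraint `x(t) ≤ 1/9` on `[0,1]`, and its second derivative
has control energy `∫₀¹ x''(t)² dt = 8`. -/
theorem bryson_denham_achievability :
    ∃ v a : ℝ → ℝ,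
      (∀ t ∈ Icc (0:ℝ) 1, HasDerivWithinAt brysonDenhamX (v t) (Icc 0 1) t) ∧
      (∀ t ∈ Icc (0:ℝ) 1, HasDerivWithinAt v (a t) (Icc 0 1) t) ∧
      ContinuousOn a (Icc 0 1) ∧
      brysonDenhamX 0 = 0 ∧ v 0 = 1 ∧ brysonDenhamX 1 = 0 ∧ v 1 = -1 ∧
      (∀ t ∈ Icc (0:ℝ) 1, brysonDenhamX t ≤ 1 / 9) ∧
      (∫ t in (0:ℝ)..1, (a t) ^ 2) = 8 := by
  refine ⟨fun t => max (-3 * t + 1) 0 ^ 2 - max (3 * t + -2) 0 ^ 2,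
    fun t => -6 * max (-3 * t + 1) 0 - 6 * max (3 * t + -2) 0,
    fun t _ => ?_, fun t _ => ?_, by fun_prop, ?_, ?_, ?_, ?_, fun t _ => ?_, ?_⟩
  · rw [brysonDenhamX_eq_max]
    refine HasDerivAt.hasDerivWithinAt ?_
    refine HasDerivAt.congr_deriv ((((hasDerivAt_max_affine_pow 1 (-3) 1 t).const_sub 1).sub
      (hasDerivAt_max_affine_pow 1 3 (-2) t)).const_mul (1 / 9)) ?_
    push_cast
    ring
  · refine HasDerivAt.hasDerivWithinAt ?_
    refine HasDerivAt.congr_deriv ((hasDerivAt_max_affine_pow 0 (-3) 1 t).sub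
      (hasDerivAt_max_affine_pow 0 3 (-2) t)) ?_
    push_cast
    ring
  · norm_num [brysonDenhamX]
  · norm_num
  · norm_num [brysonDenhamX]
  · norm_num
  · rw [brysonDenhamX_eq_max]
    have h₁ : 0 ≤ max (-3 * t + 1) 0 ^ 3 := by positivity
    have h₂ : 0 ≤ max (3 * t + -2) 0 ^ 3 := by positivity
    linarith
  · have hF : ∀ t : ℝ, HasDerivAt
        (fun t : ℝ => 4 * (max (3 * t + -2) 0 ^ 3 - max (-3 * t + 1) 0 ^ 3))
        ((-6 * max (-3 * t + 1) 0 - 6 * max (3 * t + -2) 0) ^ 2) t := by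
      intro t
      have hdisj : max (-3 * t + 1) 0 * max (3 * t + -2) 0 = 0 := by
        rcases le_total t (1 / 2) with h | h
        · rw [max_eq_right (by linarith : 3 * t + -2 ≤ 0), mul_zero]
        · rw [max_eq_right (by linarith : -3 * t + 1 ≤ 0), zero_mul]
      refine HasDerivAt.congr_deriv (((hasDerivAt_max_affine_pow 1 3 (-2) t).sub
        (hasDerivAt_max_affine_pow 1 (-3) 1 t)).const_mul 4) ?_
      push_cast
      linear_combination (-72) * hdisj
    rw [integral_eq_sub_of_hasDerivAt (fun t _ => hF t)
      (Continuous.intervalIntegrable (by fun_prop) _ _)]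
    norm_num
end
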